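/- arXiv:1602.06518 — 3 statements merged into one kernel-verified Lean document; each statement's English description precedes it below -/
import Mathlib

section
/- Let I ⊆ {1,…,T}, let α ∈ Λ^I, let t ∈ {1,…,T} be any target task, and let H be a hypothesis class. Then for every h ∈ H: |Σ_{i∈I} α_i er_i(h) − er_t(h)| ≤ Σ_{i∈I} α_i (disc(D_i,D_t) + λ_{it}). -/
open MeasureTheory Finset

noncomputable section

/-- The 0/1 loss on labels in `{-1,1} ⊆ ℤ`. -/
def loss01 (y y' : ℤ) : ℝ := if y = y' then 0 else 1

/-- Expected risk of hypothesis `h` on the task `⟨D, f⟩`. -/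
def expRisk {X : Type*} [MeasurableSpace X] (D : Measure X) (f h : X → ℤ) : ℝ :=
  ∫ x, loss01 (h x) (f x) ∂D

/-- Discrepancy between two distributions w.r.t. hypothesis class `H`:
`disc(D,D') = sup_{h,h'∈H} |E_D ℓ(h,h') − E_{D'} ℓ(h,h')|`. -/
def discD {X : Type*} [MeasurableSpace X] (H : Set (X → ℤ)) (D D' : Measure X) : ℝ :=
  ⨆ p : H × H,
    |(∫ x, loss01 ((p.1 : X → ℤ) x) ((p.2 : X → ℤ) x) ∂D)
      - ∫ x, loss01 ((p.1 : X → ℤ) x) ((p.2 : X → ℤ) x) ∂D'|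

/-- `λ_{ij} = inf_{h ∈ H} (er_i(h) + er_j(h))`. -/
def lambdaPair {X : Type*} [MeasurableSpace X] (H : Set (X → ℤ))
    (D D' : Measure X) (f f' : X → ℤ) : ℝ :=
  ⨅ h : H, (expRisk D f h + expRisk D' f' h)

/-- `α ∈ Λ^I`: entries in `[0,1]`, summing to one, supported in `I`. -/
def memSimplexOn {T : ℕ} (I : Finset (Fin T)) (α : Fin T → ℝ) : Prop :=
  (∀ i, 0 ≤ α i ∧ α i ≤ 1) ∧ (∑ i, α i = 1) ∧ (∀ i, α i ≠ 0 → i ∈ I)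

theorem loss01_nonneg (a b : ℤ) : 0 ≤ loss01 a b := by
  unfold loss01; split_ifs <;> norm_num

theorem loss01_le_one (a b : ℤ) : loss01 a b ≤ 1 := by
  unfold loss01; split_ifs <;> norm_num

theorem loss01_comm (a b : ℤ) : loss01 a b = loss01 b a := by
  unfold loss01; simp only [eq_comm]

theorem loss01_triangle (a b c : ℤ) : loss01 a c ≤ loss01 a b + loss01 b c := by
  unfold loss01; split_ifs <;> first | omega | norm_num

section

variable {X : Type*} [MeasurableSpace X]

theorem integrable_loss01 (D : Measure X) [IsFiniteMeasure D] {u v : X → ℤ}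
    (hu : Measurable u) (hv : Measurable v) :
    Integrable (fun x => loss01 (u x) (v x)) D := by
  have hm : Measurable (fun x => loss01 (u x) (v x)) :=
    Measurable.ite (measurableSet_eq_fun hu hv) measurable_const measurable_const
  refine Integrable.of_bound hm.aestronglyMeasurable 1 (Filter.Eventually.of_forall fun x => ?_)
  rw [Real.norm_of_nonneg (loss01_nonneg _ _)]
  exact loss01_le_one _ _

theorem integral_loss01_nonneg (D : Measure X) (u v : X → ℤ) :
    0 ≤ ∫ x, loss01 (u x) (v x) ∂D :=
  integral_nonneg fun _ => loss01_nonneg _ _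

theorem integral_loss01_le_one (D : Measure X) [IsProbabilityMeasure D] {u v : X → ℤ}
    (hu : Measurable u) (hv : Measurable v) : ∫ x, loss01 (u x) (v x) ∂D ≤ 1 := by
  have := integral_mono (integrable_loss01 D hu hv) (integrable_const (1 : ℝ))
    fun x => loss01_le_one (u x) (v x)
  simpa using this

theorem integral_loss01_comm (D : Measure X) (u v : X → ℤ) :
    ∫ x, loss01 (u x) (v x) ∂D = ∫ x, loss01 (v x) (u x) ∂D := by
  simp only [loss01_comm]

theorem integral_loss01_triangle (D : Measure X) [IsFiniteMeasure D] {u v w : X → ℤ}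
    (hu : Measurable u) (hv : Measurable v) (hw : Measurable w) :
    ∫ x, loss01 (u x) (w x) ∂D ≤
      (∫ x, loss01 (u x) (v x) ∂D) + ∫ x, loss01 (v x) (w x) ∂D := by
  rw [← integral_add (integrable_loss01 D hu hv) (integrable_loss01 D hv hw)]
  exact integral_mono (integrable_loss01 D hu hw)
    ((integrable_loss01 D hu hv).add (integrable_loss01 D hv hw))
    fun x => loss01_triangle (u x) (v x) (w x)

theorem abs_expRisk_sub_integral_loss01_le (D : Measure X) [IsFiniteMeasure D] {f g h : X → ℤ}
    (hf : Measurable f) (hg : Measurable g) (hh : Measurable h) :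
    |expRisk D f h - ∫ x, loss01 (h x) (g x) ∂D| ≤ expRisk D f g := by
  have h₁ := integral_loss01_triangle D hh hg hf
  have h₂ := integral_loss01_triangle D hh hf hg
  rw [integral_loss01_comm D f g] at h₂
  unfold expRisk
  rw [abs_le]
  constructor <;> linarith

theorem abs_integral_loss01_sub_le_discD {H : Set (X → ℤ)} (hH : ∀ h ∈ H, Measurable h)
    (D D' : Measure X) [IsProbabilityMeasure D] [IsProbabilityMeasure D'] {g h : X → ℤ}
    (hg : g ∈ H) (hh : h ∈ H) :
    |(∫ x, loss01 (h x) (g x) ∂D) - ∫ x, loss01 (h x) (g x) ∂D'| ≤ discD H D D' := by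
  refine le_ciSup (f := fun p : H × H =>
    |(∫ x, loss01 ((p.1 : X → ℤ) x) ((p.2 : X → ℤ) x) ∂D)
      - ∫ x, loss01 ((p.1 : X → ℤ) x) ((p.2 : X → ℤ) x) ∂D'|)
    ⟨1, ?_⟩ (⟨h, hh⟩, ⟨g, hg⟩)
  rintro _ ⟨⟨⟨u, hu⟩, ⟨v, hv⟩⟩, rfl⟩
  have h₁ := integral_loss01_nonneg D u v
  have h₂ := integral_loss01_nonneg D' u v
  have h₃ := integral_loss01_le_one D (hH u hu) (hH v hv)
  have h₄ := integral_loss01_le_one D' (hH u hu) (hH v hv)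
  exact abs_le.2 ⟨by linarith, by linarith⟩

theorem abs_expRisk_sub_expRisk_le {H : Set (X → ℤ)} (hH : ∀ h ∈ H, Measurable h)
    (D D' : Measure X) [IsProbabilityMeasure D] [IsProbabilityMeasure D'] {f f' h : X → ℤ}
    (hf : Measurable f) (hf' : Measurable f') (hh : h ∈ H) :
    |expRisk D f h - expRisk D' f' h| ≤ discD H D D' + lambdaPair H D D' f f' := by
  have : Nonempty H := ⟨⟨h, hh⟩⟩
  rw [← sub_le_iff_le_add']
  refine le_ciInf fun ⟨g, hg⟩ => ?_
  have h₁ := abs_le.1 (abs_expRisk_sub_integral_loss01_le D hf (hH g hg) (hH h hh))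
  have h₂ := abs_le.1 (abs_expRisk_sub_integral_loss01_le D' hf' (hH g hg) (hH h hh))
  have h₃ := abs_le.1 (abs_integral_loss01_sub_le_discD hH D D' hg hh)
  rw [sub_le_iff_le_add', abs_le]
  constructor <;> linarith [h₁.1, h₁.2, h₂.1, h₂.2, h₃.1, h₃.2]

end

/-- For `I ⊆ {1,…,T}`, `α ∈ Λ^I`, any target task `t`, and every `h ∈ H`:
`|Σ_{i∈I} α_i er_i(h) − er_t(h)| ≤ Σ_{i∈I} α_i (disc(D_i,D_t) + λ_{it})`. -/
theorem weighted_risk_transfer_bound {X : Type*} [MeasurableSpace X] {T : ℕ}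
    (H : Set (X → ℤ)) (P : Fin T → Measure X) (f : Fin T → X → ℤ)
    (hP : ∀ t, IsProbabilityMeasure (P t))
    (hHmeas : ∀ h ∈ H, Measurable h) (hfmeas : ∀ t, Measurable (f t))
    (hHrange : ∀ h ∈ H, ∀ x, h x = 1 ∨ h x = -1)
    (hfrange : ∀ t x, f t x = 1 ∨ f t x = -1)
    (I : Finset (Fin T)) (α : Fin T → ℝ) (hα : memSimplexOn I α)
    (t : Fin T) (h : X → ℤ) (hh : h ∈ H) :
    |(∑ i ∈ I, α i * expRisk (P i) (f i) h) - expRisk (P t) (f t) h|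
      ≤ ∑ i ∈ I, α i * (discD H (P i) (P t) + lambdaPair H (P i) (P t) (f i) (f t)) := by
  have hsum : ∑ i ∈ I, α i = 1 := by
    rw [← hα.2.1]
    refine Finset.sum_subset (Finset.subset_univ I) fun i _ hi => ?_
    by_contra hne
    exact hi (hα.2.2 i hne)
  have heq : (∑ i ∈ I, α i * expRisk (P i) (f i) h) - expRisk (P t) (f t) h
      = ∑ i ∈ I, α i * (expRisk (P i) (f i) h - expRisk (P t) (f t) h) := by
    simp only [mul_sub, Finset.sum_sub_distrib, ← Finset.sum_mul, hsum, one_mul]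
  rw [heq]
  refine (Finset.abs_sum_le_sum_abs _ _).trans (Finset.sum_le_sum fun i _ => ?_)
  rw [abs_mul, abs_of_nonneg (hα.1 i).1]
  have := hP i
  have := hP t
  exact mul_le_mul_of_nonneg_left
    (abs_expRisk_sub_expRisk_le hHmeas (P i) (P t) (hfmeas i) (hfmeas t) hh) (hα.1 i).1

end
end

section
/- Let H be a hypothesis class of binary classifiers with VC dimension d, and let S_1 and S_2 be i.i.d. samples of size n drawn from distributions D_1 and D_2 respectively. Then for any δ > 0, with probability at least 1−δ: disc(D_1,D_2) ≤ disc(S_1,S_2) + 2√((2d log(2n) + log(2/δ))/n). -/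
open MeasureTheory Finset

noncomputable section

/-- Empirical error between two hypotheses on a sample of size `n`. -/
def empPair {X : Type*} {n : ℕ} (S : Fin n → X) (h h' : X → ℤ) : ℝ :=
  (n : ℝ)⁻¹ * ∑ j, loss01 (h (S j)) (h' (S j))

/-- Empirical discrepancy between two samples of size `n`. -/
def discS {X : Type*} {n : ℕ} (H : Set (X → ℤ)) (S S' : Fin n → X) : ℝ :=
  ⨆ p : H × H,
    |empPair S (p.1 : X → ℤ) (p.2 : X → ℤ) - empPair S' (p.1 : X → ℤ) (p.2 : X → ℤ)|

/-- `H` shatters the finite set `s` (as a class of `{−1,1}`-valued classifiers). -/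
def Shatters {X : Type*} (H : Set (X → ℤ)) (s : Finset X) : Prop :=
  ∀ t ⊆ s, ∃ h ∈ H, ∀ x ∈ s, (h x = 1 ↔ x ∈ t)

/-- `H` has VC dimension `d`. -/
def VCDimEq {X : Type*} (H : Set (X → ℤ)) (d : ℕ) : Prop :=
  (∃ s : Finset X, s.card = d ∧ Shatters H s) ∧ ∀ s : Finset X, Shatters H s → s.card ≤ d

theorem loss01_mem_Icc (y y' : ℤ) : loss01 y y' ∈ Set.Icc (0 : ℝ) 1 := by
  unfold loss01
  split_ifs <;> simp

theorem measurable_loss01 {X : Type*} [MeasurableSpace X] {h h' : X → ℤ}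
    (hh : Measurable h) (hh' : Measurable h') : Measurable fun x => loss01 (h x) (h' x) :=
  (measurable_of_countable fun q : ℤ × ℤ => loss01 q.1 q.2).comp (hh.prodMk hh')

theorem measurable_empPair {X : Type*} [MeasurableSpace X] {n : ℕ} {h h' : X → ℤ}
    (hh : Measurable h) (hh' : Measurable h') :
    Measurable fun S : Fin n → X => empPair S h h' :=
  (Finset.measurable_sum _ fun j _ =>
    (measurable_loss01 hh hh').comp (measurable_pi_apply j)).const_mul _

theorem empPair_mem_Icc {X : Type*} {n : ℕ} (S : Fin n → X) (h h' : X → ℤ) :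
    empPair S h h' ∈ Set.Icc (0 : ℝ) 1 := by
  unfold empPair
  have h0 : 0 ≤ ∑ j, loss01 (h (S j)) (h' (S j)) :=
    Finset.sum_nonneg fun j _ => (loss01_mem_Icc _ _).1
  have h1 : ∑ j, loss01 (h (S j)) (h' (S j)) ≤ n := by
    simpa using Finset.sum_le_card_nsmul univ (fun j => loss01 (h (S j)) (h' (S j))) 1
      fun j _ => (loss01_mem_Icc _ _).2
  refine ⟨by positivity, ?_⟩
  rcases Nat.eq_zero_or_pos n with rfl | hn
  · simp
  · rw [inv_mul_le_iff₀ (by positivity)]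
    simpa using h1

theorem abs_empPair_sub_le_discS {X : Type*} {n : ℕ} {H : Set (X → ℤ)} (S S' : Fin n → X)
    (p : H × H) : |empPair S p.1 p.2 - empPair S' p.1 p.2| ≤ discS H S S' := by
  refine le_ciSup (f := fun p : H × H => |empPair S (p.1 : X → ℤ) (p.2 : X → ℤ)
    - empPair S' (p.1 : X → ℤ) (p.2 : X → ℤ)|) ⟨1, ?_⟩ p
  rintro _ ⟨q, rfl⟩
  obtain ⟨h0, h1⟩ := empPair_mem_Icc S (q.1 : X → ℤ) q.2
  obtain ⟨h0', h1'⟩ := empPair_mem_Icc S' (q.1 : X → ℤ) q.2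
  exact abs_sub_le_iff.2 ⟨by linarith, by linarith⟩

/-- One-sided Hoeffding inequality for an i.i.d. sample drawn from a product measure. -/
theorem measureReal_pi_sum_sub_integral_ge_le {X : Type*} [MeasurableSpace X] (D : Measure X)
    [IsProbabilityMeasure D] {n : ℕ} (hn : 0 < n) {g : X → ℝ} (hg : Measurable g) {a : ℝ}
    (hb : ∀ x, g x ∈ Set.Icc a (a + 1)) {s : ℝ} (hs : 0 ≤ s) :
    (Measure.pi fun _ : Fin n => D).real {S | n * s ≤ ∑ j, (g (S j) - ∫ x, g x ∂D)}
      ≤ Real.exp (-(2 * n * s ^ 2)) := by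
  have hsub : ∀ j ∈ (univ : Finset (Fin n)), ProbabilityTheory.HasSubgaussianMGF
      (fun S : Fin n → X => g (S j) - ∫ x, g x ∂D) ((‖(1 : ℝ)‖₊ / 2) ^ 2)
      (Measure.pi fun _ : Fin n => D) := by
    intro j _
    have := ProbabilityTheory.hasSubgaussianMGF_of_mem_Icc
      (μ := Measure.pi fun _ : Fin n => D) (X := fun S : Fin n → X => g (S j))
      (hg.comp (measurable_pi_apply j)).aemeasurable (Filter.Eventually.of_forall fun S => hb (S j))
    rwa [integral_comp_eval (μ := fun _ : Fin n => D) hg.aestronglyMeasurable,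
      add_sub_cancel_left] at this
  have hind := ProbabilityTheory.iIndepFun_pi (μ := fun _ : Fin n => D)
    (X := fun _ x => g x - ∫ x, g x ∂D) fun _ => (hg.sub_const _).aemeasurable
  refine (ProbabilityTheory.HasSubgaussianMGF.measure_sum_ge_le_of_iIndepFun hind hsub
    (by positivity : 0 ≤ n * s)).trans (Real.exp_le_exp.2 (le_of_eq ?_))
  have : (n : ℝ) ≠ 0 := by positivity
  simp only [sum_const, card_univ, Fintype.card_fin, nsmul_eq_mul]
  push_cast
  simp only [norm_one]
  field_simp

/-- Two-sided Hoeffding inequality for the empirical disagreement of a fixed pair. -/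
theorem measureReal_pi_abs_empPair_sub_ge_le {X : Type*} [MeasurableSpace X] (D : Measure X)
    [IsProbabilityMeasure D] {n : ℕ} (hn : 0 < n) {h h' : X → ℤ} (hh : Measurable h)
    (hh' : Measurable h') {s : ℝ} (hs : 0 ≤ s) :
    (Measure.pi fun _ : Fin n => D).real
        {S | s ≤ |empPair S h h' - ∫ x, loss01 (h x) (h' x) ∂D|}
      ≤ 2 * Real.exp (-(2 * n * s ^ 2)) := by
  have hm := measurable_loss01 hh hh'
  have hupper := measureReal_pi_sum_sub_integral_ge_le D hn hm (a := 0)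
    (fun x => by simpa using loss01_mem_Icc (h x) (h' x)) hs
  have hlower := measureReal_pi_sum_sub_integral_ge_le D hn hm.neg (a := -1)
    (fun x => by
      obtain ⟨h0, h1⟩ := loss01_mem_Icc (h x) (h' x)
      constructor <;> simp only [Pi.neg_apply] <;> linarith) hs
  simp only [Pi.neg_apply, integral_neg] at hlower
  refine (measureReal_mono (s₂ := _ ∪ _) ?_).trans
    ((measureReal_union_le _ _).trans ((add_le_add hupper hlower).trans_eq (two_mul _).symm))
  intro S hS
  have hn' : (0 : ℝ) < n := by positivity
  have hsum : (n : ℝ) * empPair S h h' = ∑ j, loss01 (h (S j)) (h' (S j)) := by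
    unfold empPair
    field_simp
  simp only [Set.mem_ofPred_eq, Set.mem_union, sum_sub_distrib, sum_neg_distrib, sum_const,
    card_univ, Fintype.card_fin, nsmul_eq_mul, ← hsum] at hS ⊢
  rcases le_abs.1 hS with h1 | h1
  · left
    nlinarith
  · right
    nlinarith

/-- The loss of a fixed pair is estimated from both samples simultaneously. -/
theorem measureReal_prod_abs_empPair_sub_ge_le {X : Type*} [MeasurableSpace X]
    (D₁ D₂ : Measure X) [IsProbabilityMeasure D₁] [IsProbabilityMeasure D₂] {n : ℕ} (hn : 0 < n)
    {h h' : X → ℤ} (hh : Measurable h) (hh' : Measurable h') {s : ℝ} (hs : 0 ≤ s) :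
    ((Measure.pi fun _ : Fin n => D₁).prod (Measure.pi fun _ : Fin n => D₂)).real
        {p | s ≤ |empPair p.1 h h' - ∫ x, loss01 (h x) (h' x) ∂D₁| ∨
          s ≤ |empPair p.2 h h' - ∫ x, loss01 (h x) (h' x) ∂D₂|}
      ≤ 4 * Real.exp (-(2 * n * s ^ 2)) := by
  have hmeas (D : Measure X) : MeasurableSet
      {S : Fin n → X | s ≤ |empPair S h h' - ∫ x, loss01 (h x) (h' x) ∂D|} :=
    measurableSet_le measurable_const ((measurable_empPair hh hh').sub_const _).abs
  have h₁ := measureReal_pi_abs_empPair_sub_ge_le D₁ hn hh hh' hs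
  have h₂ := measureReal_pi_abs_empPair_sub_ge_le D₂ hn hh hh' hs
  rw [← (measurePreserving_fst (μ := Measure.pi fun _ : Fin n => D₁)
    (ν := Measure.pi fun _ : Fin n => D₂)).measureReal_preimage
      (hmeas D₁).nullMeasurableSet] at h₁
  rw [← (measurePreserving_snd (μ := Measure.pi fun _ : Fin n => D₁)
    (ν := Measure.pi fun _ : Fin n => D₂)).measureReal_preimage
      (hmeas D₂).nullMeasurableSet] at h₂
  refine (measureReal_union_le _ _).trans ((add_le_add h₁ h₂).trans_eq ?_)
  ring

/-- Lemma 1 of Ben-David et al.: for i.i.d. samples `S_1 ∼ D_1^n`,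
`S_2 ∼ D_2^n` (independent of each other), with probability at least `1 − δ`:
`disc(D_1,D_2) ≤ disc(S_1,S_2) + 2√((2d log(2n) + log(2/δ))/n)`. -/
theorem disc_estimation {X : Type*} [MeasurableSpace X]
    (H : Set (X → ℤ)) (d : ℕ) (hVC : VCDimEq H d) (hd : 0 < d)
    (hHmeas : ∀ h ∈ H, Measurable h)
    (hHrange : ∀ h ∈ H, ∀ x, h x = 1 ∨ h x = -1)
    (D₁ D₂ : Measure X) (hD₁ : IsProbabilityMeasure D₁) (hD₂ : IsProbabilityMeasure D₂)
    (n : ℕ) (hn : 0 < n) (δ : ℝ) (hδ : 0 < δ) :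
    ENNReal.ofReal (1 - δ) ≤
      ((Measure.pi fun _ : Fin n => D₁).prod (Measure.pi fun _ : Fin n => D₂))
        {p : (Fin n → X) × (Fin n → X) |
          discD H D₁ D₂ ≤ discS H p.1 p.2
            + 2 * Real.sqrt ((2 * d * Real.log (2 * n) + Real.log (2 / δ)) / n)} := by
  rcases le_or_gt 1 δ with hδ1 | hδ1
  · rw [ENNReal.ofReal_of_nonpos (by linarith)]
    exact zero_le
  set L : ℝ := 2 * d * Real.log (2 * n) + Real.log (2 / δ)
  have hn' : (0 : ℝ) < n := by positivity
  have hLlower : Real.log (8 / δ) ≤ L := by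
    have hlog2 : Real.log 2 ≤ Real.log (2 * n) :=
      Real.log_le_log (by norm_num) (by linarith [(Nat.one_le_cast (α := ℝ)).2 hn])
    have hd1 : (1 : ℝ) ≤ d := Nat.one_le_cast.2 hd
    have h8 : Real.log (8 / δ) = 2 * Real.log 2 + Real.log (2 / δ) := by
      rw [show (8 : ℝ) / δ = 2 ^ 2 * (2 / δ) by ring,
        Real.log_mul (by norm_num) (by positivity), Real.log_pow]
      norm_num
    have := Real.log_nonneg (by norm_num : (1 : ℝ) ≤ 2)
    nlinarith
  have hLpos : 0 < L := (Real.log_pos ((one_lt_div hδ).2 (by linarith))).trans_le hLlower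
  have hsqrt : 0 < Real.sqrt (L / n) := Real.sqrt_pos.2 (by positivity)
  set s : ℝ := 3 / 4 * Real.sqrt (L / n) with hs
  have hs0 : 0 ≤ s := by positivity
  have htail : 4 * Real.exp (-(2 * n * s ^ 2)) ≤ δ := by
    have hsq : 2 * n * s ^ 2 = 9 / 8 * L := by
      rw [hs, mul_pow, Real.sq_sqrt (by positivity)]
      field_simp
      norm_num
    have hexp : Real.exp (-(2 * n * s ^ 2)) ≤ δ / 8 := by
      rw [hsq, ← inv_div 8 δ, ← Real.exp_log (show (0 : ℝ) < 8 / δ by positivity), ← Real.exp_neg]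
      exact Real.exp_le_exp.2 (by linarith)
    linarith
  obtain ⟨t, -, ht⟩ := hVC.1
  obtain ⟨h₀, hh₀, -⟩ := ht ∅ (empty_subset t)
  have : Nonempty (H × H) := ⟨⟨h₀, hh₀⟩, ⟨h₀, hh₀⟩⟩
  obtain ⟨p, hp⟩ := exists_lt_of_lt_ciSup
    (show discD H D₁ D₂ - Real.sqrt (L / n) / 2 < discD H D₁ D₂ by linarith)
  have hm₁ := hHmeas _ p.1.2
  have hm₂ := hHmeas _ p.2.2
  have hbad := (measureReal_prod_abs_empPair_sub_ge_le D₁ D₂ hn hm₁ hm₂ hs0).trans htail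
  have hmeas : MeasurableSet {q : (Fin n → X) × (Fin n → X) |
      s ≤ |empPair q.1 p.1 p.2 - ∫ x, loss01 ((p.1 : X → ℤ) x) ((p.2 : X → ℤ) x) ∂D₁| ∨
      s ≤ |empPair q.2 p.1 p.2 - ∫ x, loss01 ((p.1 : X → ℤ) x) ((p.2 : X → ℤ) x) ∂D₂|} :=
    (measurableSet_le measurable_const
      (((measurable_empPair hm₁ hm₂).comp measurable_fst).sub_const _).abs).union
    (measurableSet_le measurable_const
      (((measurable_empPair hm₁ hm₂).comp measurable_snd).sub_const _).abs)
  have hgood := probReal_compl_eq_one_sub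
    (μ := (Measure.pi fun _ : Fin n => D₁).prod (Measure.pi fun _ : Fin n => D₂)) hmeas
  refine (ENNReal.ofReal_le_ofReal
    ((sub_le_sub_left hbad 1).trans hgood.ge)).trans ?_
  rw [ofReal_measureReal]
  refine measure_mono ?_
  intro q hq
  simp only [Set.mem_compl_iff, Set.mem_ofPred_eq, not_or, not_le] at hq ⊢
  have hemp := abs_empPair_sub_le_discS q.1 q.2 p
  obtain ⟨h1, h1'⟩ := abs_lt.1 hq.1
  obtain ⟨h2, h2'⟩ := abs_lt.1 hq.2
  obtain ⟨h3, h3'⟩ := abs_le.1 hemp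
  rcases lt_abs.1 hp with h4 | h4 <;> linarith

end
end

section
/- Let {v_1,…,v_N} ⊂ ℝ^d be a finite set of d-dimensional vectors, let W_1,…,W_m be sampled from {v_1,…,v_N} uniformly without replacement, and let U_1,…,U_m be sampled from {v_1,…,v_N} uniformly with replacement (i.i.d.). Then for every continuous convex function F : ℝ^d → ℝ: E[F(Σ_{i=1}^m W_i)] ≤ E[F(Σ_{i=1}^m U_i)]. -/
open Finset

section

variable {ι α E : Type*} [Fintype ι] [DecidableEq ι] [Fintype α]

/-- Summed over all permutations `ρ`, the value `x (ρ k)` does not depend on `k`. -/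
theorem Equiv.Perm.sum_apply_eq_sum_apply [AddCommMonoid E] (x : ι → E) (k l : ι) :
    ∑ ρ : Equiv.Perm ι, x (ρ k) = ∑ ρ : Equiv.Perm ι, x (ρ l) := by
  rw [← Equiv.sum_comp (Equiv.mulRight (Equiv.swap k l))]
  simp

theorem Equiv.Perm.sum_sum_apply_comp [AddCommMonoid E] (x : ι → E) (h : ι → ι) :
    ∑ ρ : Equiv.Perm ι, ∑ i, x (ρ (h i)) = Fintype.card (Equiv.Perm ι) • ∑ i, x i := by
  rw [sum_comm, sum_congr rfl fun i _ => sum_apply_eq_sum_apply x (h i) i, sum_comm,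
    sum_congr rfl fun (ρ : Equiv.Perm ι) _ => Equiv.sum_comp ρ x]
  simp

/-- Jensen's inequality for the uniform average over a nonempty finite type. -/
theorem ConvexOn.card_mul_map_le_sum [AddCommGroup E] [Module ℝ E] {F : E → ℝ}
    (hF : ConvexOn ℝ Set.univ F) {κ : Type*} [Fintype κ] [Nonempty κ] (y : κ → E) (z : E)
    (hz : ∑ k, y k = Fintype.card κ • z) :
    (Fintype.card κ : ℝ) * F z ≤ ∑ k, F (y k) := by
  have hc : (0 : ℝ) < Fintype.card κ := by exact_mod_cast Fintype.card_pos
  have key := hF.map_sum_le (t := univ) (w := fun _ : κ => (Fintype.card κ : ℝ)⁻¹) (p := y)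
    (fun _ _ => by positivity) (by simp [hc.ne']) (fun _ _ => Set.mem_univ _)
  rw [← smul_sum, ← smul_sum, hz, ← Nat.cast_smul_eq_nsmul ℝ, inv_smul_smul₀ hc.ne',
    smul_eq_mul] at key
  rwa [le_inv_mul_iff₀ hc] at key

/-- Precomposing a uniformly random injection with a fixed self-map of the index type does not
decrease the expectation of a convex function of the sum. -/
theorem ConvexOn.sum_embedding_le_sum_embedding_comp [AddCommGroup E] [Module ℝ E] {F : E → ℝ}
    (hF : ConvexOn ℝ Set.univ F) (v : α → E) (h : ι → ι) :
    ∑ σ : ι ↪ α, F (∑ i, v (σ i)) ≤ ∑ σ : ι ↪ α, F (∑ i, v (σ (h i))) := by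
  have hc : (0 : ℝ) < Fintype.card (Equiv.Perm ι) := by exact_mod_cast Fintype.card_pos
  refine le_of_mul_le_mul_left ?_ hc
  calc (Fintype.card (Equiv.Perm ι) : ℝ) * ∑ σ : ι ↪ α, F (∑ i, v (σ i))
      ≤ ∑ σ : ι ↪ α, ∑ ρ : Equiv.Perm ι, F (∑ i, v (σ (ρ (h i)))) := by
        rw [mul_sum]
        exact sum_le_sum fun σ _ => hF.card_mul_map_le_sum _ _
          (Equiv.Perm.sum_sum_apply_comp (fun i => v (σ i)) h)
    _ = ∑ ρ : Equiv.Perm ι, ∑ σ : ι ↪ α, F (∑ i, v (σ (h i))) := by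
        rw [sum_comm]
        exact sum_congr rfl fun ρ _ =>
          Equiv.sum_comp (Equiv.embeddingCongr ρ.symm (Equiv.refl α))
            fun σ : ι ↪ α => F (∑ i, v (σ (h i)))
    _ = _ := by simp

/-- A uniformly random permutation restricts to a uniformly random injection. -/
theorem Equiv.Perm.card_mul_sum_trans_embedding [DecidableEq α] {m : ℕ}
    (G : (Fin m ↪ α) → ℝ) (τ : Fin m ↪ α) :
    (Fintype.card (Fin m ↪ α) : ℝ) * ∑ π : Equiv.Perm α, G (τ.trans π.toEmbedding) =
      Fintype.card (Equiv.Perm α) * ∑ σ, G σ := by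
  have hindep (σ : Fin m ↪ α) : ∑ π : Equiv.Perm α, G (σ.trans π.toEmbedding) =
      ∑ π : Equiv.Perm α, G (τ.trans π.toEmbedding) := by
    obtain ⟨π₀, rfl⟩ := ((Equiv.Perm.isMultiplyPretransitive α m).exists_smul_eq τ σ)
    exact Equiv.sum_comp (Equiv.mulRight π₀) fun π => G (τ.trans π.toEmbedding)
  calc _ = ∑ σ : Fin m ↪ α, ∑ π : Equiv.Perm α, G (σ.trans π.toEmbedding) := by
        simp [hindep]
    _ = ∑ π : Equiv.Perm α, ∑ σ, G σ := by
        rw [sum_comm]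
        exact sum_congr rfl fun π _ =>
          Equiv.sum_comp (Equiv.embeddingCongr (Equiv.refl (Fin m)) π) G
    _ = _ := by simp

theorem exists_embedding_comp_eq [DecidableEq α] {m : ℕ} (hm : m ≤ Fintype.card α) (f : Fin m → α) :
    ∃ (τ : Fin m ↪ α) (h : Fin m → Fin m), ∀ i, τ (h i) = f i := by
  obtain ⟨s, hs, hcard⟩ := exists_superset_card_eq (s := univ.image f)
    (card_image_le.trans (by simp)) hm
  let e := s.equivFinOfCardEq hcard
  exact ⟨e.symm.toEmbedding.trans (.subtype _), fun i => e ⟨f i, hs (by simp)⟩, fun i => by simp⟩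

end

/-- Hoeffding: sampling `m` of the `N` vectors `v_1,…,v_N` uniformly
without replacement (`W`, modelled as a uniformly random injection `Fin m ↪ Fin N`) versus
uniformly with replacement (`U`, modelled as a uniformly random function `Fin m → Fin N`):
for every continuous convex `F : ℝ^d → ℝ`, `E[F(Σ_i W_i)] ≤ E[F(Σ_i U_i)]`.
Both expectations are written as uniform averages over the respective finite sample
spaces. -/
theorem hoeffding_sampling_without_replacement {N d m : ℕ} (hN : 0 < N) (hm : m ≤ N)
    (v : Fin N → (Fin d → ℝ)) (F : (Fin d → ℝ) → ℝ)
    (hFcont : Continuous F) (hFconv : ConvexOn ℝ Set.univ F) :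
    (Fintype.card (Fin m ↪ Fin N) : ℝ)⁻¹ *
        ∑ σ : Fin m ↪ Fin N, F (∑ i : Fin m, v (σ i))
      ≤ (Fintype.card (Fin m → Fin N) : ℝ)⁻¹ *
          ∑ g : Fin m → Fin N, F (∑ i : Fin m, v (g i)) := by
  have hE : (0 : ℝ) < Fintype.card (Fin m ↪ Fin N) := by
    have : Nonempty (Fin m ↪ Fin N) := ⟨Fin.castLEEmb hm⟩
    exact_mod_cast Fintype.card_pos
  have hP : (0 : ℝ) < Fintype.card (Equiv.Perm (Fin N)) := by exact_mod_cast Fintype.card_pos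
  have hU : (0 : ℝ) < Fintype.card (Fin m → Fin N) := by
    have : Nonempty (Fin m → Fin N) := ⟨Fin.castLE hm⟩
    exact_mod_cast Fintype.card_pos
  rw [inv_mul_le_iff₀ hE, mul_left_comm, le_inv_mul_iff₀ hU]
  refine le_of_mul_le_mul_left ?_ hP
  have hf (f : Fin m → Fin N) :
      (Fintype.card (Equiv.Perm (Fin N)) : ℝ) * ∑ σ : Fin m ↪ Fin N, F (∑ i, v (σ i)) ≤
        Fintype.card (Fin m ↪ Fin N) * ∑ π : Equiv.Perm (Fin N), F (∑ i, v (π (f i))) := by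
    obtain ⟨τ, h, hτ⟩ := exists_embedding_comp_eq (by simpa using hm) f
    have key := Equiv.Perm.card_mul_sum_trans_embedding
      (fun σ : Fin m ↪ Fin N => F (∑ i, v (σ (h i)))) τ
    simp only [Function.Embedding.trans_apply, Equiv.coe_toEmbedding, hτ] at key
    rw [key]
    exact mul_le_mul_of_nonneg_left (hFconv.sum_embedding_le_sum_embedding_comp v h) hP.le
  calc _ = ∑ f : Fin m → Fin N,
        (Fintype.card (Equiv.Perm (Fin N)) : ℝ) * ∑ σ : Fin m ↪ Fin N, F (∑ i, v (σ i)) := by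
        rw [sum_const, card_univ, nsmul_eq_mul, mul_left_comm]
    _ ≤ ∑ f : Fin m → Fin N,
        Fintype.card (Fin m ↪ Fin N) * ∑ π : Equiv.Perm (Fin N), F (∑ i, v (π (f i))) :=
      sum_le_sum fun f _ => hf f
    _ = Fintype.card (Fin m ↪ Fin N) *
        ∑ π : Equiv.Perm (Fin N), ∑ g : Fin m → Fin N, F (∑ i, v (g i)) := by
      rw [← mul_sum, sum_comm]
      congr 1
      exact sum_congr rfl fun π _ =>
        Equiv.sum_comp (Equiv.arrowCongr (Equiv.refl (Fin m)) π)
          fun g : Fin m → Fin N => F (∑ i, v (g i))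
    _ = _ := by
      rw [sum_const, card_univ, nsmul_eq_mul, mul_left_comm]
end
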